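/- Let y = μ^(i) + ξ ℓ v + w with ξ ∈ ℝ and ⟨w, v⟩ = 0. Then μ̂(y) − y = (γ_j(y) − ξ) ℓ v − w + E, where E := Σ_{k∉{i,j}} γ_k(y) (μ^(k) − μ^(i)). Moreover, if y satisfies two-mode dominance for (i,j) with margin parameter κ > 0, then ‖E‖ ≤ (N−2) · (max_{k∉{i,j}} ‖μ^(k) − μ^(i)‖) · ((max_{k∉{i,j}} π_k)/min(π_i, π_j)) · exp(−κ). -/

import Mathlib

open Set Finset
open scoped InnerProductSpace

/-- Responsibility of mode `k` at `y`, with variance parameter `σ̃²`. -/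
noncomputable def resp {ϖ N : ℕ} (μ : Fin N → EuclideanSpace ℝ (Fin ϖ))
    (π : Fin N → ℝ) (σ : ℝ) (k : Fin N) (y : EuclideanSpace ℝ (Fin ϖ)) : ℝ :=
  π k * Real.exp (-‖y - μ k‖ ^ 2 / (2 * σ ^ 2)) /
    ∑ m : Fin N, π m * Real.exp (-‖y - μ m‖ ^ 2 / (2 * σ ^ 2))

/-- Posterior mean `μ̂(y) = ∑ₖ γₖ(y) μ⁽ᵏ⁾`. -/
noncomputable def postMean {ϖ N : ℕ} (μ : Fin N → EuclideanSpace ℝ (Fin ϖ))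
    (π : Fin N → ℝ) (σ : ℝ) (y : EuclideanSpace ℝ (Fin ϖ)) : EuclideanSpace ℝ (Fin ϖ) :=
  ∑ k : Fin N, resp μ π σ k y • μ k

/-- Two-mode dominance for the pair `(i,j)` with margin parameter `κ` and variance `σ̃²`. -/
def TwoModeDominance {ϖ N : ℕ} (μ : Fin N → EuclideanSpace ℝ (Fin ϖ))
    (σ : ℝ) (i j : Fin N) (κ : ℝ) (y : EuclideanSpace ℝ (Fin ϖ)) : Prop :=
  ∀ k : Fin N, k ≠ i → k ≠ j →
    ‖y - μ k‖ ^ 2 ≥ min (‖y - μ i‖ ^ 2) (‖y - μ j‖ ^ 2) + 2 * σ ^ 2 * κ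

section Responsibilities

variable {ϖ N : ℕ} (μ : Fin N → EuclideanSpace ℝ (Fin ϖ)) {π : Fin N → ℝ} (σ : ℝ)
  (y : EuclideanSpace ℝ (Fin ϖ))

lemma resp_nonneg (hπ : ∀ k, 0 < π k) (k : Fin N) : 0 ≤ resp μ π σ k y :=
  div_nonneg (mul_pos (hπ k) (Real.exp_pos _)).le
    (Finset.sum_nonneg fun m _ => (mul_pos (hπ m) (Real.exp_pos _)).le)

lemma sum_resp_eq_one [Nonempty (Fin N)] (hπ : ∀ k, 0 < π k) :
    ∑ k, resp μ π σ k y = 1 := by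
  unfold resp
  rw [← Finset.sum_div]
  exact div_self (Finset.sum_pos (fun m _ => mul_pos (hπ m) (Real.exp_pos _))
    Finset.univ_nonempty).ne'

variable {σ y}

/-- A mode `k` whose squared distance to `y` exceeds that of mode `m` by `2σ²κ` has
responsibility at most `(π k / π m) exp (-κ)`. -/
lemma resp_le_of_sq_dist_le (hπ : ∀ k, 0 < π k) (hσ : 0 < σ) {k m : Fin N} {κ : ℝ}
    (h : ‖y - μ m‖ ^ 2 + 2 * σ ^ 2 * κ ≤ ‖y - μ k‖ ^ 2) :
    resp μ π σ k y ≤ π k / π m * Real.exp (-κ) := by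
  have hpos : 0 < π m * Real.exp (-‖y - μ m‖ ^ 2 / (2 * σ ^ 2)) :=
    mul_pos (hπ m) (Real.exp_pos _)
  have hexp : Real.exp (-‖y - μ k‖ ^ 2 / (2 * σ ^ 2)) ≤
      Real.exp (-‖y - μ m‖ ^ 2 / (2 * σ ^ 2)) * Real.exp (-κ) := by
    rw [← Real.exp_add]
    refine Real.exp_le_exp.2 ?_
    rw [div_add' _ _ _ (by positivity), div_le_div_iff_of_pos_right (by positivity)]
    linarith
  calc
    resp μ π σ k y ≤ π k * Real.exp (-‖y - μ k‖ ^ 2 / (2 * σ ^ 2)) /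
        (π m * Real.exp (-‖y - μ m‖ ^ 2 / (2 * σ ^ 2))) :=
      div_le_div_of_nonneg_left (mul_pos (hπ k) (Real.exp_pos _)).le hpos
        (Finset.single_le_sum
          (f := fun m => π m * Real.exp (-‖y - μ m‖ ^ 2 / (2 * σ ^ 2)))
          (fun m _ => (mul_pos (hπ m) (Real.exp_pos _)).le) (Finset.mem_univ m))
    _ ≤ π k * (Real.exp (-‖y - μ m‖ ^ 2 / (2 * σ ^ 2)) * Real.exp (-κ)) /
        (π m * Real.exp (-‖y - μ m‖ ^ 2 / (2 * σ ^ 2))) := by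
      have := (hπ k).le
      gcongr
    _ = π k / π m * Real.exp (-κ) := by
      have := (hπ m).ne'
      field_simp

lemma TwoModeDominance.resp_le (hπ : ∀ k, 0 < π k) (hσ : 0 < σ) {i j k : Fin N} {κ : ℝ}
    (h : TwoModeDominance μ σ i j κ y) (hi : k ≠ i) (hj : k ≠ j) :
    resp μ π σ k y ≤ π k / min (π i) (π j) * Real.exp (-κ) := by
  have hmin : 0 < min (π i) (π j) := lt_min (hπ i) (hπ j)
  have hk := h k hi hj
  have hπk := (hπ k).le
  rcases le_total (‖y - μ i‖ ^ 2) (‖y - μ j‖ ^ 2) with hle | hle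
  · rw [min_eq_left hle] at hk
    refine (resp_le_of_sq_dist_le μ hπ hσ hk).trans ?_
    gcongr
    exact min_le_left _ _
  · rw [min_eq_right hle] at hk
    refine (resp_le_of_sq_dist_le μ hπ hσ hk).trans ?_
    gcongr
    exact min_le_right _ _

end Responsibilities

lemma card_filter_ne_and_ne {N : ℕ} {i j : Fin N} (hij : i ≠ j) :
    ((Finset.univ.filter fun k : Fin N => k ≠ i ∧ k ≠ j).card : ℝ) = N - 2 := by
  have hset : (Finset.univ.filter fun k : Fin N => k ≠ i ∧ k ≠ j) = {i, j}ᶜ := by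
    ext k
    simp
  have hcard := Finset.card_add_card_compl ({i, j} : Finset (Fin N))
  rw [Finset.card_pair hij, Fintype.card_fin] at hcard
  rw [hset, eq_sub_iff_add_eq']
  exact_mod_cast hcard

/-- Decomposition of the drift `μ̂(y) − y` into parallel, orthogonal, and
residual components along the `(i,j)`-mode segment, with a bound on the residual under
two-mode dominance. -/
theorem drift_decomposition_and_residual_bound
    (ϖ N : ℕ) (hϖ : 1 ≤ ϖ) (hN : 2 ≤ N)
    (μ : Fin N → EuclideanSpace ℝ (Fin ϖ)) (π : Fin N → ℝ)
    (hπpos : ∀ k, 0 < π k) (hπsum : ∑ k : Fin N, π k = 1)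
    (σ : ℝ) (hσ : 0 < σ)
    (i j : Fin N) (hij : i ≠ j) (hμ : μ i ≠ μ j)
    (ℓ : ℝ) (hℓ : ℓ = ‖μ j - μ i‖)
    (v : EuclideanSpace ℝ (Fin ϖ)) (hv : v = ℓ⁻¹ • (μ j - μ i))
    (ξ : ℝ) (w : EuclideanSpace ℝ (Fin ϖ)) (hw : ⟪w, v⟫_ℝ = 0)
    (y : EuclideanSpace ℝ (Fin ϖ)) (hy : y = μ i + (ξ * ℓ) • v + w)
    (E : EuclideanSpace ℝ (Fin ϖ))
    (hE : E = ∑ k ∈ Finset.univ.filter (fun k : Fin N => k ≠ i ∧ k ≠ j),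
      resp μ π σ k y • (μ k - μ i)) :
    postMean μ π σ y - y = ((resp μ π σ j y - ξ) * ℓ) • v - w + E ∧
      (∀ κ : ℝ, 0 < κ → TwoModeDominance μ σ i j κ y →
        ‖E‖ ≤ (N - 2 : ℝ) * (⨆ k : {k : Fin N // k ≠ i ∧ k ≠ j}, ‖μ k.1 - μ i‖) *
          ((⨆ k : {k : Fin N // k ≠ i ∧ k ≠ j}, π k.1) / min (π i) (π j)) *
          Real.exp (-κ)) := by
  have : Nonempty (Fin N) := ⟨i⟩
  have hℓ0 : ℓ ≠ 0 := by
    rw [hℓ]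
    exact norm_ne_zero_iff.2 (sub_ne_zero.2 hμ.symm)
  have hℓv : ℓ • v = μ j - μ i := by rw [hv, smul_inv_smul₀ hℓ0]
  refine ⟨?_, fun κ _ hdom => ?_⟩
  · have hmean : postMean μ π σ y - μ i = ∑ k, resp μ π σ k y • (μ k - μ i) := by
      simp_rw [smul_sub, Finset.sum_sub_distrib, ← Finset.sum_smul,
        sum_resp_eq_one μ σ y hπpos, one_smul, postMean]
    have hsplit : ∑ k, resp μ π σ k y • (μ k - μ i) =
        resp μ π σ j y • (μ j - μ i) + E := by
      rw [hE, ← Finset.add_sum_erase _ _ (Finset.mem_univ j),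
        ← Finset.add_sum_erase (Finset.univ.erase j) _
          (Finset.mem_erase.2 ⟨hij, Finset.mem_univ i⟩), sub_self, smul_zero, zero_add]
      congr 2
      ext k
      simp
    rw [← sub_add_sub_cancel _ (μ i) y, hmean, hsplit, ← hℓv, hy]
    module
  · rw [hE]
    have hterm : ∀ k ∈ Finset.univ.filter (fun k : Fin N => k ≠ i ∧ k ≠ j),
        ‖resp μ π σ k y • (μ k - μ i)‖ ≤
          ((⨆ k : {k : Fin N // k ≠ i ∧ k ≠ j}, π k.1) / min (π i) (π j) * Real.exp (-κ)) *
            ⨆ k : {k : Fin N // k ≠ i ∧ k ≠ j}, ‖μ k.1 - μ i‖ := by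
      intro k hk
      have hk' : k ≠ i ∧ k ≠ j := (Finset.mem_filter.1 hk).2
      have hmin : 0 < min (π i) (π j) := lt_min (hπpos i) (hπpos j)
      have hπle : π k ≤ ⨆ k : {k : Fin N // k ≠ i ∧ k ≠ j}, π k.1 :=
        le_ciSup (f := fun k : {k : Fin N // k ≠ i ∧ k ≠ j} => π k.1)
          (Set.finite_range _).bddAbove ⟨k, hk'⟩
      have hμle : ‖μ k - μ i‖ ≤ ⨆ k : {k : Fin N // k ≠ i ∧ k ≠ j}, ‖μ k.1 - μ i‖ :=
        le_ciSup (f := fun k : {k : Fin N // k ≠ i ∧ k ≠ j} => ‖μ k.1 - μ i‖)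
          (Set.finite_range _).bddAbove ⟨k, hk'⟩
      have hresp : resp μ π σ k y ≤
          (⨆ k : {k : Fin N // k ≠ i ∧ k ≠ j}, π k.1) / min (π i) (π j) * Real.exp (-κ) :=
        (hdom.resp_le μ hπpos hσ hk'.1 hk'.2).trans (by gcongr)
      have hnonneg := resp_nonneg μ σ y hπpos k
      rw [norm_smul, Real.norm_of_nonneg hnonneg]
      exact mul_le_mul hresp hμle (norm_nonneg _) (hnonneg.trans hresp)
    refine (norm_sum_le_of_le _ hterm).trans_eq ?_
    rw [Finset.sum_const, nsmul_eq_mul, card_filter_ne_and_ne hij]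
    ring
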